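/- Let W = (X, Y, Z, q_{Z|X,Y}) be a channel with finite alphabets and q_X, q_Y input distributions. For every rate pair (R1, R2) in the interior of the convex closure of the set { (R1,R2) : ( R1 ≥ I(X;Z|Y) and R2 ≥ I(Y;Z) ) or ( R1 ≥ I(X;Z) and R2 ≥ I(Y;Z|X) ) }, there exist γ1, γ2 > 0 such that for all sufficiently large n, P_{C1,C2}( ||p_{Z^n|C1,C2} − q_{Z^n}|| > exp(−γ1 n) ) ≤ exp(−exp(γ2 n)). -/

import Mathlib

open scoped BigOperators Classical

noncomputable section

namespace MACResolvability

/-- A multiple-access channel with finite input alphabets `X`, `Y`, finite output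
alphabet `Z`, channel transition probabilities `W` and input distributions `qX`, `qY`. -/
structure Channel (X Y Z : Type) [Fintype X] [Fintype Y] [Fintype Z] where
  W : X → Y → Z → ℝ
  qX : X → ℝ
  qY : Y → ℝ
  W_nonneg : ∀ x y z, 0 ≤ W x y z
  W_sum_one : ∀ x y, ∑ z, W x y z = 1
  qX_nonneg : ∀ x, 0 ≤ qX x
  qX_sum_one : ∑ x, qX x = 1
  qY_nonneg : ∀ y, 0 ≤ qY y
  qY_sum_one : ∑ y, qY y = 1

/-- Number of codewords of a codebook of block length `n` and rate `R` : `exp (n R)`. -/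
def numCw (n : ℕ) (R : ℝ) : ℕ := ⌈Real.exp ((n : ℝ) * R)⌉₊

/-- Variational distance between two (mass) functions on a finite set. -/
def tvDist {α : Type} [Fintype α] (p q : α → ℝ) : ℝ := (1 / 2) * ∑ a, |p a - q a|

/-- The standard normal cumulative distribution function `Φ`. -/
def stdNormalCDF (a : ℝ) : ℝ :=
  ∫ x in Set.Iic a, Real.exp (-(x ^ 2) / 2) / Real.sqrt (2 * Real.pi)

/-- The Gaussian tail function `Q = 1 - Φ`. -/
def Qfun (a : ℝ) : ℝ := 1 - stdNormalCDF a

/-- The inverse of the Gaussian tail function `Q` on `(0,1)`. -/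
def Qinv (e : ℝ) : ℝ := Function.invFun Qfun e

variable {X Y Z : Type} [Fintype X] [Fintype Y] [Fintype Z]

namespace Channel

variable (P : Channel X Y Z)

/-- Induced joint distribution `q_{X,Y,Z}`. -/
def joint (x : X) (y : Y) (z : Z) : ℝ := P.qX x * P.qY y * P.W x y z

/-- Output distribution `q_Z`. -/
def qZ (z : Z) : ℝ := ∑ x, ∑ y, P.joint x y z

/-- Conditional output distribution `q_{Z|Y}`. -/
def qZgY (y : Y) (z : Z) : ℝ := ∑ x, P.qX x * P.W x y z

/-- Conditional output distribution `q_{Z|X}`. -/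
def qZgX (x : X) (z : Z) : ℝ := ∑ y, P.qY y * P.W x y z

/-- Conditional information density `i(x; z | y)`. -/
def iXZgY (x : X) (y : Y) (z : Z) : ℝ := Real.log (P.W x y z / P.qZgY y z)

/-- Information density `i(y; z)`. -/
def iYZ (y : Y) (z : Z) : ℝ := Real.log (P.qZgY y z / P.qZ z)

/-- Information density `i(x; z)`. -/
def iXZ (x : X) (z : Z) : ℝ := Real.log (P.qZgX x z / P.qZ z)

/-- Conditional information density `i(y; z | x)`. -/
def iYZgX (x : X) (y : Y) (z : Z) : ℝ := Real.log (P.W x y z / P.qZgX x z)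

/-- Conditional mutual information `I(X; Z | Y)`. -/
def IXZgY : ℝ := ∑ x, ∑ y, ∑ z, P.joint x y z * P.iXZgY x y z

/-- Mutual information `I(Y; Z)`. -/
def IYZ : ℝ := ∑ x, ∑ y, ∑ z, P.joint x y z * P.iYZ y z

/-- Mutual information `I(X; Z)`. -/
def IXZ : ℝ := ∑ x, ∑ y, ∑ z, P.joint x y z * P.iXZ x z

/-- Conditional mutual information `I(Y; Z | X)`. -/
def IYZgX : ℝ := ∑ x, ∑ y, ∑ z, P.joint x y z * P.iYZgX x y z

/-- Central second moment of a per-letter function of `(X,Y,Z)` under the joint. -/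
def centralMoment2 (f : X → Y → Z → ℝ) : ℝ :=
  ∑ x, ∑ y, ∑ z, P.joint x y z *
    (f x y z - ∑ x', ∑ y', ∑ z', P.joint x' y' z' * f x' y' z') ^ 2

/-- Central absolute third moment of a per-letter function of `(X,Y,Z)` under the joint. -/
def absMoment3 (f : X → Y → Z → ℝ) : ℝ :=
  ∑ x, ∑ y, ∑ z, P.joint x y z *
    |f x y z - ∑ x', ∑ y', ∑ z', P.joint x' y' z' * f x' y' z'| ^ 3

/-- Central second moment of `i(X;Z|Y)`. -/
def V1 : ℝ := P.centralMoment2 P.iXZgY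
/-- Central absolute third moment of `i(X;Z|Y)`. -/
def Tm1 : ℝ := P.absMoment3 P.iXZgY
/-- Central second moment of `i(Y;Z)`. -/
def V2 : ℝ := P.centralMoment2 fun _ y z => P.iYZ y z
/-- Central absolute third moment of `i(Y;Z)`. -/
def Tm2 : ℝ := P.absMoment3 fun _ y z => P.iYZ y z
/-- Central second moment of `i(X;Z)`. -/
def VX : ℝ := P.centralMoment2 fun x _ z => P.iXZ x z
/-- Central absolute third moment of `i(X;Z)`. -/
def TmX : ℝ := P.absMoment3 fun x _ z => P.iXZ x z
/-- Central second moment of `i(Y;Z|X)`. -/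
def VYgX : ℝ := P.centralMoment2 P.iYZgX
/-- Central absolute third moment of `i(Y;Z|X)`. -/
def TmYgX : ℝ := P.absMoment3 P.iYZgX

/-- `n`-fold product channel `q_{Z^n | X^n, Y^n}`. -/
def Wn (n : ℕ) (xs : Fin n → X) (ys : Fin n → Y) (zs : Fin n → Z) : ℝ :=
  ∏ k, P.W (xs k) (ys k) (zs k)

/-- `n`-fold product output distribution `q_{Z^n}`. -/
def qZn (n : ℕ) (zs : Fin n → Z) : ℝ := ∏ k, P.qZ (zs k)

/-- `n`-fold product conditional distribution `q_{Z^n | Y^n}`. -/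
def qZgYn (n : ℕ) (ys : Fin n → Y) (zs : Fin n → Z) : ℝ := ∏ k, P.qZgY (ys k) (zs k)

/-- `n`-letter conditional information density `i(x^n; z^n | y^n)`. -/
def iXZgYn (n : ℕ) (xs : Fin n → X) (ys : Fin n → Y) (zs : Fin n → Z) : ℝ :=
  ∑ k, P.iXZgY (xs k) (ys k) (zs k)

/-- `n`-letter information density `i(y^n; z^n)`. -/
def iYZn (n : ℕ) (ys : Fin n → Y) (zs : Fin n → Z) : ℝ := ∑ k, P.iYZ (ys k) (zs k)

/-- The typical set `T1^n(ε)`. -/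
def T1set (n : ℕ) (ε : ℝ) : Set ((Fin n → X) × (Fin n → Y) × (Fin n → Z)) :=
  {t | P.iXZgYn n t.1 t.2.1 t.2.2 ≤ (n : ℝ) * (P.IXZgY + ε)}

/-- The typical set `T2^n(ε)`. -/
def T2set (n : ℕ) (ε : ℝ) : Set ((Fin n → Y) × (Fin n → Z)) :=
  {t | P.iYZn n t.1 t.2 ≤ (n : ℝ) * (P.IYZ + ε)}

/-- Probability of an event under the `n`-fold i.i.d. joint distribution `q_{X,Y,Z}^n`. -/
def jointPn (n : ℕ) (A : Set ((Fin n → X) × (Fin n → Y) × (Fin n → Z))) : ℝ :=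
  ∑ xs : Fin n → X, ∑ ys : Fin n → Y, ∑ zs : Fin n → Z,
    (∏ k, P.joint (xs k) (ys k) (zs k)) * (if (xs, ys, zs) ∈ A then 1 else 0)

/-- Probability of an event of `(Y^n, Z^n)` under the `n`-fold i.i.d. joint distribution. -/
def jointPYZn (n : ℕ) (A : Set ((Fin n → Y) × (Fin n → Z))) : ℝ :=
  ∑ xs : Fin n → X, ∑ ys : Fin n → Y, ∑ zs : Fin n → Z,
    (∏ k, P.joint (xs k) (ys k) (zs k)) * (if (ys, zs) ∈ A then 1 else 0)

/-- Probability of an event of the pair of random codebooks, each component of each codeword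
drawn i.i.d. according to `qX` resp. `qY`. -/
def cbP2 (n M1 M2 : ℕ)
    (E : (Fin M1 → Fin n → X) → (Fin M2 → Fin n → Y) → Prop) : ℝ :=
  ∑ C1 : Fin M1 → Fin n → X, ∑ C2 : Fin M2 → Fin n → Y,
    ((∏ m, ∏ k, P.qX (C1 m k)) * (∏ m, ∏ k, P.qY (C2 m k))) *
      (if E C1 C2 then 1 else 0)

/-- Probability of an event of the random codebook `C1`. -/
def cbP1 (n M1 : ℕ) (E : (Fin M1 → Fin n → X) → Prop) : ℝ :=
  ∑ C1 : Fin M1 → Fin n → X,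
    (∏ m, ∏ k, P.qX (C1 m k)) * (if E C1 then 1 else 0)

/-- Expectation of a function of the pair of random codebooks. -/
def cbE2 (n M1 M2 : ℕ)
    (f : (Fin M1 → Fin n → X) → (Fin M2 → Fin n → Y) → ℝ) : ℝ :=
  ∑ C1 : Fin M1 → Fin n → X, ∑ C2 : Fin M2 → Fin n → Y,
    ((∏ m, ∏ k, P.qX (C1 m k)) * (∏ m, ∏ k, P.qY (C2 m k))) * f C1 C2

/-- The output distribution `p_{Z^n | C1, C2}` induced by the codebooks `C1`, `C2`. -/
def pOut (n : ℕ) (R1 R2 : ℝ) {M1 M2 : ℕ}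
    (C1 : Fin M1 → Fin n → X) (C2 : Fin M2 → Fin n → Y) (zs : Fin n → Z) : ℝ :=
  Real.exp (-((n : ℝ) * (R1 + R2))) * ∑ m1, ∑ m2, P.Wn n (C1 m1) (C2 m2) zs

/-- The atypical term `P_atyp,1` for a typical set `T1`. -/
def Patyp1 (n : ℕ) (R1 R2 : ℝ) {M1 M2 : ℕ}
    (C1 : Fin M1 → Fin n → X) (C2 : Fin M2 → Fin n → Y)
    (T1 : Set ((Fin n → X) × (Fin n → Y) × (Fin n → Z))) : ℝ :=
  ∑ zs : Fin n → Z, Real.exp (-((n : ℝ) * (R1 + R2))) *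
    ∑ m1, ∑ m2, P.Wn n (C1 m1) (C2 m2) zs *
      (if (C1 m1, C2 m2, zs) ∈ T1 then 0 else 1)

/-- The atypical term `P_atyp,2` for a typical set `T2`. -/
def Patyp2 (n : ℕ) (R1 R2 : ℝ) {M1 M2 : ℕ}
    (C1 : Fin M1 → Fin n → X) (C2 : Fin M2 → Fin n → Y)
    (T2 : Set ((Fin n → Y) × (Fin n → Z))) : ℝ :=
  ∑ zs : Fin n → Z, Real.exp (-((n : ℝ) * (R1 + R2))) *
    ∑ m1, ∑ m2, P.Wn n (C1 m1) (C2 m2) zs *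
      (if (C2 m2, zs) ∈ T2 then 0 else 1)

/-- The typical term `T_typ(z^n)`. -/
def Ttyp (n : ℕ) (R1 R2 : ℝ) {M1 M2 : ℕ}
    (C1 : Fin M1 → Fin n → X) (C2 : Fin M2 → Fin n → Y)
    (T1 : Set ((Fin n → X) × (Fin n → Y) × (Fin n → Z)))
    (T2 : Set ((Fin n → Y) × (Fin n → Z))) (zs : Fin n → Z) : ℝ :=
  ∑ m1, ∑ m2, Real.exp (-((n : ℝ) * (R1 + R2))) *
    (P.Wn n (C1 m1) (C2 m2) zs / P.qZn n zs) *
    (if (C2 m2, zs) ∈ T2 then 1 else 0) *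
    (if (C1 m1, C2 m2, zs) ∈ T1 then 1 else 0)

/-- The typical term `T_typ,1(y^n, z^n)` of the first codebook. -/
def Ttyp1 (n : ℕ) (R1 : ℝ) {M1 : ℕ} (C1 : Fin M1 → Fin n → X)
    (ys : Fin n → Y) (zs : Fin n → Z)
    (T1 : Set ((Fin n → X) × (Fin n → Y) × (Fin n → Z))) : ℝ :=
  ∑ m1, Real.exp (-((n : ℝ) * R1)) *
    (P.Wn n (C1 m1) ys zs / P.qZgYn n ys zs) *
    (if (C1 m1, ys, zs) ∈ T1 then 1 else 0)

end Channel

/-! ### Finite expectations -/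

/-- Probability mass function on a finite type. -/
structure IsP {A : Type} [Fintype A] (w : A → ℝ) : Prop where
  nonneg : ∀ a, 0 ≤ w a
  sum : ∑ a, w a = 1

/-- Weighted average. -/
def av {A : Type} [Fintype A] (w : A → ℝ) (f : A → ℝ) : ℝ := ∑ a, w a * f a

/-- Product weights. -/
def pw {A : Type} (w : A → ℝ) (M : ℕ) (C : Fin M → A) : ℝ := ∏ m, w (C m)

section abstractPart

variable {A B D : Type} [Fintype A] [Fintype B] [Fintype D]

lemma av_add (w : A → ℝ) (f g : A → ℝ) : av w (fun a => f a + g a) = av w f + av w g := by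
  simp [av, mul_add, Finset.sum_add_distrib]

lemma av_sub (w : A → ℝ) (f g : A → ℝ) : av w (fun a => f a - g a) = av w f - av w g := by
  simp [av, mul_sub, Finset.sum_sub_distrib]

lemma av_mul (w : A → ℝ) (c : ℝ) (f : A → ℝ) : av w (fun a => c * f a) = c * av w f := by
  simp only [av, Finset.mul_sum]
  exact Finset.sum_congr rfl fun a _ => by ring

lemma av_const {w : A → ℝ} (hw : IsP w) (c : ℝ) : av w (fun _ => c) = c := by
  simp [av, ← Finset.sum_mul, hw.sum]

lemma av_mono {w : A → ℝ} (hw : IsP w) {f g : A → ℝ} (h : ∀ a, f a ≤ g a) : av w f ≤ av w g :=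
  Finset.sum_le_sum fun a _ => mul_le_mul_of_nonneg_left (h a) (hw.nonneg a)

lemma av_nonneg {w : A → ℝ} (hw : IsP w) {f : A → ℝ} (h : ∀ a, 0 ≤ f a) : 0 ≤ av w f :=
  Finset.sum_nonneg fun a _ => mul_nonneg (hw.nonneg a) (h a)

lemma av_abs {w : A → ℝ} (hw : IsP w) (f : A → ℝ) : |av w f| ≤ av w (fun a => |f a|) := by
  unfold av
  refine (Finset.abs_sum_le_sum_abs _ _).trans (Finset.sum_le_sum fun a _ => ?_)
  rw [abs_mul, abs_of_nonneg (hw.nonneg a)]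

lemma av_comm (u : A → ℝ) (v : B → ℝ) (f : A → B → ℝ) :
    av u (fun a => av v (fun b => f a b)) = av v (fun b => av u (fun a => f a b)) := by
  simp only [av, Finset.mul_sum]
  rw [Finset.sum_comm]
  exact Finset.sum_congr rfl fun a _ => Finset.sum_congr rfl fun b _ => by ring

lemma av_sum {ι : Type} [Fintype ι] (w : A → ℝ) (f : A → ι → ℝ) :
    av w (fun a => ∑ i, f a i) = ∑ i, av w (fun a => f a i) := by
  simp only [av, Finset.mul_sum]
  rw [Finset.sum_comm]

lemma av_pw_zero (w : A → ℝ) (f : (Fin 0 → A) → ℝ) : av (pw w 0) f = f Fin.elim0 := by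
  simp only [av, pw, Finset.univ_unique, Finset.sum_singleton, Finset.univ_eq_empty,
    Finset.prod_empty, one_mul]
  congr 1

lemma av_pw_succ (w : A → ℝ) (M : ℕ) (f : (Fin (M + 1) → A) → ℝ) :
    av (pw w (M + 1)) f = av w (fun a => av (pw w M) (fun C => f (Fin.cons a C))) := by
  simp only [av, pw]
  rw [← (Fin.consEquiv (fun _ : Fin (M + 1) => A)).sum_comp, Fintype.sum_prod_type]
  refine Finset.sum_congr rfl fun a _ => ?_
  rw [Finset.mul_sum]
  refine Finset.sum_congr rfl fun C _ => ?_
  simp [Fin.consEquiv, Fin.prod_univ_succ, mul_assoc]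

lemma pw_isP {w : A → ℝ} (hw : IsP w) (M : ℕ) : IsP (pw w M) := by
  refine ⟨fun C => Finset.prod_nonneg fun m _ => hw.nonneg _, ?_⟩
  have h : ∀ M, av (pw w M) (fun _ => (1 : ℝ)) = 1 := by
    intro M
    induction M with
    | zero => exact av_pw_zero _ _
    | succ M ih => rw [av_pw_succ, ih, av_const hw]
  have := h M
  simpa [av] using this

lemma av_pw_sum {w : A → ℝ} (hw : IsP w) (φ : A → ℝ) (M : ℕ) :
    av (pw w M) (fun C => ∑ m, φ (C m)) = M * av w φ := by
  induction M with
  | zero => rw [av_pw_zero]; simp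
  | succ M ih =>
    rw [av_pw_succ]
    simp only [Fin.sum_univ_succ, Fin.cons_zero, Fin.cons_succ]
    simp only [av_add, ih, av_const (pw_isP hw M), av_const hw]
    push_cast; ring

lemma av_pw_prod (w : A → ℝ) (φ : A → ℝ) (M : ℕ) :
    av (pw w M) (fun C => ∏ m, φ (C m)) = (av w φ) ^ M := by
  induction M with
  | zero => rw [av_pw_zero]; simp
  | succ M ih =>
    rw [av_pw_succ]
    simp only [Fin.prod_univ_succ, Fin.cons_zero, Fin.cons_succ, av_mul, ih]
    have e : (fun a => φ a * av w φ ^ M) = fun a => av w φ ^ M * φ a := by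
      funext a; ring
    rw [e, av_mul, pow_succ]

lemma exp_le_quad {x : ℝ} (hx : |x| ≤ 1) : Real.exp x ≤ 1 + x + x ^ 2 := by
  have := Real.abs_exp_sub_one_sub_id_le hx
  have := (abs_le.1 this).2
  linarith

/-- McDiarmid-type moment generating function bound. -/
lemma mcdiarmid {w : A → ℝ} (hw : IsP w) {s c : ℝ} (hs : 0 ≤ s) (hsc : s * c ≤ 1) (M : ℕ) :
    ∀ f : (Fin M → A) → ℝ, (∀ C m a, |f (Function.update C m a) - f C| ≤ c) →
      av (pw w M) (fun C => Real.exp (s * (f C - av (pw w M) f))) ≤ Real.exp (M * (s * c) ^ 2) := by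
  induction M with
  | zero => intro f _; rw [av_pw_zero, av_pw_zero]; simp
  | succ M ih =>
    intro f hf
    set g : A → ℝ := fun a => av (pw w M) (fun C => f (Fin.cons a C)) with hg
    have hmean : av (pw w (M + 1)) f = av w g := av_pw_succ _ _ _
    rw [hmean, av_pw_succ]
    have h1 : ∀ a, av (pw w M) (fun C => Real.exp (s * (f (Fin.cons a C) - g a)))
        ≤ Real.exp (M * (s * c) ^ 2) := by
      intro a
      refine ih (fun C => f (Fin.cons a C)) fun C m b => ?_
      have := hf (Fin.cons a C) m.succ b
      rwa [← Fin.cons_update] at this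
    have hgd : ∀ a b, |g a - g b| ≤ c := by
      intro a b
      rw [hg]
      simp only [← av_sub]
      refine (av_abs (pw_isP hw M) _).trans ?_
      refine (av_mono (pw_isP hw M) (g := fun _ => c) fun C => ?_).trans_eq
        (av_const (pw_isP hw M) c)
      have := hf (Fin.cons b C) 0 a
      rwa [Fin.update_cons_zero] at this
    have hgm : ∀ a, |g a - av w g| ≤ c := by
      intro a
      have : g a - av w g = av w (fun b => g a - g b) := by
        rw [av_sub, av_const hw]
      rw [this]
      exact (av_abs hw _).trans ((av_mono hw (g := fun _ => c) fun b => hgd a b).trans_eq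
        (av_const hw c))
    have h2 : av w (fun a => Real.exp (s * (g a - av w g))) ≤ Real.exp ((s * c) ^ 2) := by
      calc av w (fun a => Real.exp (s * (g a - av w g)))
          ≤ av w (fun a => (1 + (s * c) ^ 2) + s * (g a - av w g)) := by
            refine av_mono hw fun a => ?_
            have hx : |s * (g a - av w g)| ≤ s * c := by
              rw [abs_mul, abs_of_nonneg hs]
              exact mul_le_mul_of_nonneg_left (hgm a) hs
            have := exp_le_quad (hx.trans hsc)
            have h3 : (s * (g a - av w g)) ^ 2 ≤ (s * c) ^ 2 := by
              rw [← sq_abs]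
              exact pow_le_pow_left₀ (abs_nonneg _) hx 2
            linarith
        _ = 1 + (s * c) ^ 2 := by
            rw [av_add, av_const hw, av_mul, av_sub, av_const hw]; ring
        _ ≤ _ := by linarith [Real.add_one_le_exp ((s * c) ^ 2)]
    calc av w (fun a => av (pw w M) fun C => Real.exp (s * (f (Fin.cons a C) - av w g)))
        = av w (fun a => Real.exp (s * (g a - av w g)) *
            av (pw w M) (fun C => Real.exp (s * (f (Fin.cons a C) - g a)))) := by
          congr 1; funext a
          rw [← av_mul]
          congr 1; funext C
          rw [← Real.exp_add]; congr 1; ring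
      _ ≤ av w (fun a => Real.exp (M * (s * c) ^ 2) * Real.exp (s * (g a - av w g))) := by
          refine av_mono hw fun a => ?_
          rw [mul_comm]
          exact mul_le_mul_of_nonneg_right (h1 a) (Real.exp_pos _).le
      _ ≤ Real.exp (M * (s * c) ^ 2) * Real.exp ((s * c) ^ 2) := by
          rw [av_mul]
          exact mul_le_mul_of_nonneg_left h2 (Real.exp_pos _).le
      _ = _ := by rw [← Real.exp_add]; congr 1; push_cast; ring

lemma av_sq_le {w : A → ℝ} (hw : IsP w) (f : A → ℝ) :
    (av w f) ^ 2 ≤ av w (fun a => f a ^ 2) := by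
  have h : 0 ≤ av w (fun a => (f a - av w f) ^ 2) := av_nonneg hw fun a => sq_nonneg _
  have e : av w (fun a => (f a - av w f) ^ 2) = av w (fun a => f a ^ 2) - av w f ^ 2 := by
    have : (fun a => (f a - av w f) ^ 2) =
        fun a => f a ^ 2 + ((-2 * av w f) * f a + av w f ^ 2) := by funext a; ring
    rw [this, av_add, av_add, av_mul, av_const hw]; ring
  linarith

lemma var_bound {w : A → ℝ} (hw : IsP w) (φ : A → ℝ) (M : ℕ) : ∀ t : ℝ,
    av (pw w M) (fun C => (∑ m, φ (C m) - t) ^ 2)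
      ≤ M * av w (fun a => φ a ^ 2) + (M * av w φ - t) ^ 2 := by
  induction M with
  | zero => intro t; rw [av_pw_zero]; simp
  | succ M ih =>
    intro t
    rw [av_pw_succ]
    simp only [Fin.sum_univ_succ, Fin.cons_zero, Fin.cons_succ]
    have h1 : ∀ a, av (pw w M) (fun C => (φ a + ∑ m, φ (C m) - t) ^ 2)
        ≤ (M * av w (fun a => φ a ^ 2) + (M * av w φ - t) ^ 2) +
          (φ a ^ 2 + (2 * (M * av w φ - t)) * φ a) := by
      intro a
      have := ih (t - φ a)
      have e : (fun C : Fin M → A => (φ a + ∑ m, φ (C m) - t) ^ 2) =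
          fun C => (∑ m, φ (C m) - (t - φ a)) ^ 2 := by funext C; ring
      rw [e]; refine this.trans_eq ?_; ring
    refine (av_mono hw h1).trans ?_
    simp only [av_add, av_const hw, av_mul]
    push_cast
    nlinarith [sq_nonneg (av w φ)]

lemma var_bound2 {u : A → ℝ} {v : B → ℝ} (hu : IsP u) (hv : IsP v) (h : A → B → ℝ) (M1 M2 : ℕ) :
    av (pw u M1) (fun C1 => av (pw v M2) (fun C2 =>
      (∑ m1, ∑ m2, h (C1 m1) (C2 m2) - M1 * M2 * av u (fun a => av v (h a))) ^ 2))
    ≤ M1 * M2 * av u (fun a => av v (fun b => h a b ^ 2))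
      + M1 ^ 2 * M2 * av v (fun b => av u (fun a => h a b) ^ 2)
      + M1 * M2 ^ 2 * av u (fun a => av v (h a) ^ 2) := by
  set μ := av u (fun a => av v (h a)) with hμ
  have h1 : ∀ C1 : Fin M1 → A, av (pw v M2) (fun C2 =>
      (∑ m1, ∑ m2, h (C1 m1) (C2 m2) - M1 * M2 * μ) ^ 2)
      ≤ M2 * av v (fun b => (∑ m1, h (C1 m1) b - 0) ^ 2) +
        M2 ^ 2 * (∑ m1, av v (h (C1 m1)) - M1 * μ) ^ 2 := by
    intro C1
    have := var_bound hv (fun b => ∑ m1, h (C1 m1) b) M2 (M1 * M2 * μ)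
    have e : (fun C2 : Fin M2 → B => (∑ m1, ∑ m2, h (C1 m1) (C2 m2) - M1 * M2 * μ) ^ 2) =
        fun C2 => (∑ m2, ∑ m1, h (C1 m1) (C2 m2) - M1 * M2 * μ) ^ 2 := by
      funext C2; rw [Finset.sum_comm]
    rw [e]
    refine this.trans_eq ?_
    rw [av_sum]
    simp only [sub_zero]
    ring
  refine (av_mono (pw_isP hu M1) h1).trans ?_
  rw [av_add, av_mul, av_mul, av_comm]
  have h2 : ∀ b, av (pw u M1) (fun C1 => (∑ m1, h (C1 m1) b - 0) ^ 2)
      ≤ M1 * av u (fun a => h a b ^ 2) + M1 ^ 2 * av u (fun a => h a b) ^ 2 := by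
    intro b
    refine (var_bound hu (fun a => h a b) M1 0).trans_eq ?_
    ring
  have h3 := av_mono hv h2
  rw [av_add, av_mul, av_mul] at h3
  rw [av_comm u v (fun a b => h a b ^ 2)]
  have h4 := var_bound hu (fun a => av v (h a)) M1 (M1 * μ)
  rw [← hμ, sub_self] at h4
  have h5 := mul_le_mul_of_nonneg_left h3 (Nat.cast_nonneg (α := ℝ) M2)
  have h6 := mul_le_mul_of_nonneg_left h4 (sq_nonneg (M2 : ℝ))
  linarith

end abstractPart

section oneShot

set_option linter.unusedSectionVars false

variable {A B D : Type} [Fintype A] [Fintype B] [Fintype D]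

/-- Concentration for a function of two independent random codebooks. -/
lemma conc {u : A → ℝ} {v : B → ℝ} (hu : IsP u) (hv : IsP v) {M1 M2 : ℕ}
    (f : (Fin M1 → A) → (Fin M2 → B) → ℝ) {s c1 c2 : ℝ} (hs : 0 ≤ s)
    (h1 : s * c1 ≤ 1) (h2 : s * c2 ≤ 1)
    (hd1 : ∀ C1 C2 m a, |f (Function.update C1 m a) C2 - f C1 C2| ≤ c1)
    (hd2 : ∀ C1 C2 m b, |f C1 (Function.update C2 m b) - f C1 C2| ≤ c2) (t : ℝ) :
    av (pw u M1) (fun C1 => av (pw v M2) (fun C2 => if f C1 C2 > t then 1 else 0)) ≤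
      Real.exp (s * (av (pw u M1) (fun C1 => av (pw v M2) (f C1)) - t)
        + M1 * (s * c1) ^ 2 + M2 * (s * c2) ^ 2) := by
  have hU := pw_isP hu M1
  have hV := pw_isP hv M2
  set g : (Fin M1 → A) → ℝ := fun C1 => av (pw v M2) (f C1) with hg
  set m := av (pw u M1) g with hm
  have hin : ∀ C1, av (pw v M2) (fun C2 => if f C1 C2 > t then (1 : ℝ) else 0) ≤
      Real.exp (s * (m - t) + M2 * (s * c2) ^ 2) * Real.exp (s * (g C1 - m)) := by
    intro C1
    calc av (pw v M2) (fun C2 => if f C1 C2 > t then (1 : ℝ) else 0)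
        ≤ av (pw v M2) (fun C2 => Real.exp (s * (g C1 - t)) *
            Real.exp (s * (f C1 C2 - g C1))) := by
          refine av_mono hV fun C2 => ?_
          rw [← Real.exp_add]
          split_ifs with h
          · rw [← Real.exp_zero]
            apply Real.exp_le_exp.2
            have : 0 ≤ s * (f C1 C2 - t) := mul_nonneg hs (by linarith)
            linarith
          · exact (Real.exp_pos _).le
      _ ≤ Real.exp (s * (g C1 - t)) * Real.exp (M2 * (s * c2) ^ 2) := by
          rw [av_mul]
          exact mul_le_mul_of_nonneg_left
            (mcdiarmid hv hs h2 M2 (f C1) (fun C2 m b => hd2 C1 C2 m b)) (Real.exp_pos _).le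
      _ = _ := by rw [← Real.exp_add, ← Real.exp_add]; congr 1; ring
  refine (av_mono hU hin).trans ?_
  rw [av_mul]
  have hout := mcdiarmid hu hs h1 M1 g (by
    intro C1 k a
    rw [hg]
    simp only [← av_sub]
    exact (av_abs hV _).trans ((av_mono hV (g := fun _ => c1)
      fun C2 => hd1 C1 C2 k a).trans_eq (av_const hV c1)))
  refine (mul_le_mul_of_nonneg_left hout (Real.exp_pos _).le).trans_eq ?_
  rw [← Real.exp_add]; congr 1; ring

/-- Bounded differences of the (doubled) variational distance. -/
lemma sum_update_diff {M : ℕ} (C : Fin M → A) (k : Fin M) (a : A) (φ : A → ℝ) :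
    ∑ m, φ (Function.update C k a m) - ∑ m, φ (C m) = φ a - φ (C k) := by
  rw [← Finset.sum_sub_distrib, Finset.sum_eq_single k]
  · simp
  · intro b _ hb; simp [Function.update_of_ne hb]
  · simp

/-- Output of a pair of codebooks. -/
def outp (L : ℝ) (K : A → B → D → ℝ) {M1 M2 : ℕ} (C1 : Fin M1 → A) (C2 : Fin M2 → B) (z : D) : ℝ :=
  L * ∑ m1, ∑ m2, K (C1 m1) (C2 m2) z

lemma outp_diff1 {L : ℝ} (hL : 0 ≤ L) {K : A → B → D → ℝ} (hK : ∀ a b z, 0 ≤ K a b z)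
    (hK1 : ∀ a b, ∑ z, K a b z = 1) (q : D → ℝ) {M1 M2 : ℕ}
    (C1 : Fin M1 → A) (C2 : Fin M2 → B) (k : Fin M1) (a : A) :
    |tvDist (outp L K (Function.update C1 k a) C2) q - tvDist (outp L K C1 C2) q| ≤ L * M2 := by
  have key : ∀ z, outp L K (Function.update C1 k a) C2 z - outp L K C1 C2 z =
      L * ∑ m2, (K a (C2 m2) z - K (C1 k) (C2 m2) z) := by
    intro z
    unfold outp
    rw [← mul_sub, sum_update_diff C1 k a (fun x => ∑ m2, K x (C2 m2) z), Finset.sum_sub_distrib]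
  unfold tvDist
  rw [← mul_sub, ← Finset.sum_sub_distrib, abs_mul, abs_of_pos (by norm_num : (0 : ℝ) < 1 / 2)]
  have h1 : |∑ z, (|outp L K (Function.update C1 k a) C2 z - q z| - |outp L K C1 C2 z - q z|)|
      ≤ ∑ z, L * ∑ m2, (K a (C2 m2) z + K (C1 k) (C2 m2) z) := by
    refine (Finset.abs_sum_le_sum_abs _ _).trans (Finset.sum_le_sum fun z _ => ?_)
    refine (abs_abs_sub_abs_le_abs_sub _ _).trans ?_
    rw [sub_sub_sub_cancel_right, key z, abs_mul, abs_of_nonneg hL]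
    refine mul_le_mul_of_nonneg_left ?_ hL
    refine (Finset.abs_sum_le_sum_abs _ _).trans (Finset.sum_le_sum fun m _ => ?_)
    have := hK a (C2 m) z
    have := hK (C1 k) (C2 m) z
    rw [abs_le]; constructor <;> linarith
  rw [← Finset.mul_sum, Finset.sum_comm] at h1
  simp only [Finset.sum_add_distrib, hK1] at h1
  simp only [Finset.sum_const, Finset.card_univ, Fintype.card_fin, nsmul_eq_mul, mul_one] at h1
  linarith

lemma outp_swap (L : ℝ) (K : A → B → D → ℝ) {M1 M2 : ℕ} (C1 : Fin M1 → A) (C2 : Fin M2 → B) :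
    outp L K C1 C2 = outp L (fun b a => K a b) C2 C1 := by
  funext z; unfold outp; rw [Finset.sum_comm]

lemma outp_diff2 {L : ℝ} (hL : 0 ≤ L) {K : A → B → D → ℝ} (hK : ∀ a b z, 0 ≤ K a b z)
    (hK1 : ∀ a b, ∑ z, K a b z = 1) (q : D → ℝ) {M1 M2 : ℕ}
    (C1 : Fin M1 → A) (C2 : Fin M2 → B) (k : Fin M2) (b : B) :
    |tvDist (outp L K C1 (Function.update C2 k b)) q - tvDist (outp L K C1 C2) q| ≤ L * M1 := by
  rw [outp_swap, outp_swap L K C1 C2]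
  exact outp_diff1 hL (fun b a z => hK a b z) (fun b a => hK1 a b) q C2 C1 k b

lemma ex_outp {u : A → ℝ} {v : B → ℝ} (hu : IsP u) (hv : IsP v) (L : ℝ) (K : A → B → D → ℝ)
    (M1 M2 : ℕ) (z : D) :
    av (pw u M1) (fun C1 => av (pw v M2) (fun C2 => outp L K C1 C2 z)) =
      L * (M1 * M2) * av u (fun a => av v (fun b => K a b z)) := by
  unfold outp
  have h : ∀ C1 : Fin M1 → A, av (pw v M2) (fun C2 => L * ∑ m1, ∑ m2, K (C1 m1) (C2 m2) z) =
      (L * M2) * ∑ m1, av v (fun b => K (C1 m1) b z) := by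
    intro C1
    rw [av_mul, av_sum, Finset.mul_sum, Finset.mul_sum]
    refine Finset.sum_congr rfl fun m _ => ?_
    rw [av_pw_sum hv (fun b => K (C1 m) b z)]; ring
  simp only [h]
  rw [av_mul, av_pw_sum hu (fun a => av v (fun b => K a b z))]; ring

/-- One-shot soft covering for the multiple access channel, in expectation. -/
lemma oneShot {u : A → ℝ} {v : B → ℝ} (hu : IsP u) (hv : IsP v)
    {K : A → B → D → ℝ} (hK : ∀ a b z, 0 ≤ K a b z) (hK1 : ∀ a b, ∑ z, K a b z = 1)
    {q : D → ℝ} (hq : ∀ z, q z = av u (fun a => av v (fun b => K a b z)))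
    (T : A → B → D → Prop) {E12 E1 E2 : ℝ} (hE12 : 0 ≤ E12) (hE1 : 0 ≤ E1) (hE2 : 0 ≤ E2)
    (hT12 : ∀ a b z, T a b z → K a b z ≤ E12 * q z)
    (hT1 : ∀ a b z, T a b z → av v (fun b => K a b z) ≤ E1 * q z)
    (hT2 : ∀ a b z, T a b z → av u (fun a => K a b z) ≤ E2 * q z)
    {L : ℝ} (hL : 0 ≤ L) (M1 M2 : ℕ) {ε : ℝ} (hε : 0 ≤ ε)
    (hLε : L ^ 2 * (M1 * M2 * E12 + M1 ^ 2 * M2 * E2 + M1 * M2 ^ 2 * E1) ≤ ε ^ 2) :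
    av (pw u M1) (fun C1 => av (pw v M2) (fun C2 => ∑ z, |outp L K C1 C2 z - q z|)) ≤
      ε + 2 * (L * (M1 * M2)) *
        av u (fun a => av v (fun b => ∑ z, K a b z * (if T a b z then 0 else 1)))
        + |L * (M1 * M2) - 1| := by
  have hU := pw_isP hu M1
  have hV := pw_isP hv M2
  set κ := L * ((M1 : ℝ) * M2) with hκ
  have hκ0 : 0 ≤ κ := by positivity
  set KT : A → B → D → ℝ := fun a b z => if T a b z then K a b z else 0 with hKT
  set KN : A → B → D → ℝ := fun a b z => K a b z * (if T a b z then 0 else 1) with hKN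
  have hKT0 : ∀ a b z, 0 ≤ KT a b z := by
    intro a b z; simp only [hKT]; split_ifs; exacts [hK a b z, le_rfl]
  have hKTle : ∀ a b z, KT a b z ≤ K a b z := by
    intro a b z; simp only [hKT]; split_ifs; exacts [le_rfl, hK a b z]
  have hKN0 : ∀ a b z, 0 ≤ KN a b z := by
    intro a b z; simp only [hKN]; split_ifs <;> simp [hK a b z]
  have hsplit : ∀ a b z, K a b z = KT a b z + KN a b z := by
    intro a b z; simp only [hKT, hKN]; split_ifs <;> simp
  set qT : D → ℝ := fun z => av u (fun a => av v (fun b => KT a b z)) with hqT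
  set qN : D → ℝ := fun z => av u (fun a => av v (fun b => KN a b z)) with hqN
  have hqs : ∀ z, q z = qT z + qN z := by
    intro z; rw [hq z]; simp only [hsplit, av_add, hqT, hqN]
  have hqT0 : ∀ z, 0 ≤ qT z := fun z => av_nonneg hu fun a => av_nonneg hv fun b => hKT0 a b z
  have hqN0 : ∀ z, 0 ≤ qN z := fun z => av_nonneg hu fun a => av_nonneg hv fun b => hKN0 a b z
  have hq0 : ∀ z, 0 ≤ q z := fun z => by rw [hqs]; exact add_nonneg (hqT0 z) (hqN0 z)
  have hqTq : ∀ z, qT z ≤ q z := fun z => by rw [hqs]; linarith [hqN0 z]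
  have hqsum : ∑ z, q z = 1 := by
    simp only [hq, ← av_sum, hK1, av_const hv, av_const hu]
  have houtp : ∀ (C1 : Fin M1 → A) (C2 : Fin M2 → B) z,
      outp L K C1 C2 z = outp L KT C1 C2 z + outp L KN C1 C2 z := by
    intro C1 C2 z
    simp only [outp, hsplit, Finset.sum_add_distrib, mul_add]
  have houtN : ∀ (C1 : Fin M1 → A) (C2 : Fin M2 → B) z, 0 ≤ outp L KN C1 C2 z := by
    intro C1 C2 z
    exact mul_nonneg hL (Finset.sum_nonneg fun _ _ => Finset.sum_nonneg fun _ _ => hKN0 _ _ _)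
  -- variance bound
  have hvar : ∀ z, av (pw u M1) (fun C1 => av (pw v M2) (fun C2 =>
      |outp L KT C1 C2 z - κ * qT z|)) ≤ ε * q z := by
    intro z
    have hsq : av (pw u M1) (fun C1 => av (pw v M2) (fun C2 =>
        (outp L KT C1 C2 z - κ * qT z) ^ 2)) ≤ (ε * q z) ^ 2 := by
      have e : ∀ (C1 : Fin M1 → A) (C2 : Fin M2 → B), (outp L KT C1 C2 z - κ * qT z) ^ 2 =
          L ^ 2 * (∑ m1, ∑ m2, KT (C1 m1) (C2 m2) z - M1 * M2 * qT z) ^ 2 := by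
        intro C1 C2; simp only [outp, hκ]; ring
      simp only [e, av_mul]
      have hb := var_bound2 hu hv (fun a b => KT a b z) M1 M2
      have b12 : av u (fun a => av v (fun b => KT a b z ^ 2)) ≤ E12 * q z ^ 2 := by
        calc _ ≤ av u (fun a => av v (fun b => (E12 * q z) * KT a b z)) := by
              refine av_mono hu fun a => av_mono hv fun b => ?_
              rw [sq]
              refine mul_le_mul_of_nonneg_right ?_ (hKT0 a b z)
              by_cases h : T a b z
              · exact (hKTle a b z).trans (hT12 a b z h)
              · simp only [hKT, h, if_false]; exact mul_nonneg hE12 (hq0 z)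
          _ = (E12 * q z) * qT z := by simp only [av_mul, hqT]
          _ ≤ (E12 * q z) * q z := mul_le_mul_of_nonneg_left (hqTq z) (mul_nonneg hE12 (hq0 z))
          _ = _ := by ring
      have b1 : av u (fun a => av v (fun b => KT a b z) ^ 2) ≤ E1 * q z ^ 2 := by
        calc _ ≤ av u (fun a => (E1 * q z) * av v (fun b => KT a b z)) := by
              refine av_mono hu fun a => ?_
              rw [sq]
              refine mul_le_mul_of_nonneg_right ?_ (av_nonneg hv fun b => hKT0 a b z)
              by_cases h : ∃ b, T a b z
              · obtain ⟨b, h⟩ := h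
                exact (av_mono hv fun b => hKTle a b z).trans (hT1 a b z h)
              · push Not at h
                simp only [hKT, h, if_false, av_const hv]; exact mul_nonneg hE1 (hq0 z)
          _ = (E1 * q z) * qT z := by simp only [av_mul, hqT]
          _ ≤ (E1 * q z) * q z := mul_le_mul_of_nonneg_left (hqTq z) (mul_nonneg hE1 (hq0 z))
          _ = _ := by ring
      have b2 : av v (fun b => av u (fun a => KT a b z) ^ 2) ≤ E2 * q z ^ 2 := by
        calc _ ≤ av v (fun b => (E2 * q z) * av u (fun a => KT a b z)) := by
              refine av_mono hv fun b => ?_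
              rw [sq]
              refine mul_le_mul_of_nonneg_right ?_ (av_nonneg hu fun a => hKT0 a b z)
              by_cases h : ∃ a, T a b z
              · obtain ⟨a, h⟩ := h
                exact (av_mono hu fun a => hKTle a b z).trans (hT2 a b z h)
              · push Not at h
                simp only [hKT, h, if_false, av_const hu]; exact mul_nonneg hE2 (hq0 z)
          _ = (E2 * q z) * qT z := by
              simp only [av_mul, hqT]; rw [av_comm u v]
          _ ≤ (E2 * q z) * q z := mul_le_mul_of_nonneg_left (hqTq z) (mul_nonneg hE2 (hq0 z))
          _ = _ := by ring
      calc _ ≤ L ^ 2 * (M1 * M2 * av u (fun a => av v (fun b => KT a b z ^ 2))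
                + M1 ^ 2 * M2 * av v (fun b => av u (fun a => KT a b z) ^ 2)
                + M1 * M2 ^ 2 * av u (fun a => av v (fun b => KT a b z) ^ 2)) :=
            mul_le_mul_of_nonneg_left hb (sq_nonneg _)
        _ ≤ L ^ 2 * (M1 * M2 * (E12 * q z ^ 2) + M1 ^ 2 * M2 * (E2 * q z ^ 2)
                + M1 * M2 ^ 2 * (E1 * q z ^ 2)) := by gcongr
        _ = (L ^ 2 * (M1 * M2 * E12 + M1 ^ 2 * M2 * E2 + M1 * M2 ^ 2 * E1)) * q z ^ 2 := by ring
        _ ≤ ε ^ 2 * q z ^ 2 := mul_le_mul_of_nonneg_right hLε (sq_nonneg _)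
        _ = _ := by ring
    have hj : (av (pw u M1) (fun C1 => av (pw v M2) (fun C2 =>
        |outp L KT C1 C2 z - κ * qT z|))) ^ 2 ≤ (ε * q z) ^ 2 := by
      refine (av_sq_le hU _).trans (le_trans (av_mono hU fun C1 => ?_) hsq)
      refine (av_sq_le hV _).trans_eq ?_
      simp only [sq_abs]
    exact abs_le_of_sq_le_sq' hj (mul_nonneg hε (hq0 z)) |>.2
  have hpt : ∀ (C1 : Fin M1 → A) (C2 : Fin M2 → B), ∑ z, |outp L K C1 C2 z - q z| ≤
      ∑ z, (|outp L KT C1 C2 z - κ * qT z| + (outp L KN C1 C2 z +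
        (κ * qN z + |κ - 1| * q z))) := by
    intro C1 C2
    refine Finset.sum_le_sum fun z _ => ?_
    have e : outp L K C1 C2 z - q z = (outp L KT C1 C2 z - κ * qT z) +
        (outp L KN C1 C2 z + (-(κ * qN z) + (κ - 1) * q z)) := by
      rw [houtp, hqs]; ring
    rw [e]
    refine (abs_add_le _ _).trans (add_le_add le_rfl ?_)
    refine (abs_add_le _ _).trans (add_le_add (abs_of_nonneg (houtN _ _ _)).le ?_)
    refine (abs_add_le _ _).trans (add_le_add ?_ ?_)
    · rw [abs_neg, abs_of_nonneg (mul_nonneg hκ0 (hqN0 z))]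
    · rw [abs_mul, abs_of_nonneg (hq0 z)]
  refine (av_mono hU fun C1 => av_mono hV fun C2 => hpt C1 C2).trans ?_
  simp only [av_sum, av_add, av_const hV, av_const hU, Finset.sum_add_distrib, ex_outp hu hv]
  rw [← hκ, ← Finset.mul_sum, ← Finset.mul_sum, hqsum]
  have h1 : ∑ z, av (pw u M1) (fun C1 => av (pw v M2) (fun C2 =>
      |outp L KT C1 C2 z - κ * qT z|)) ≤ ε := by
    calc _ ≤ ∑ z, ε * q z := Finset.sum_le_sum fun z _ => hvar z
      _ = ε := by rw [← Finset.mul_sum, hqsum, mul_one]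
  change _ ≤ (ε + 2 * κ * ∑ i, av u (fun a => av v fun b => KN a b i)) + |κ - 1|
  linarith

end oneShot

section letters

variable {A : Type} [Fintype A]

lemma av_mono_supp {w : A → ℝ} (hw : IsP w) {f g : A → ℝ} (h : ∀ a, w a ≠ 0 → f a ≤ g a) :
    av w f ≤ av w g := by
  refine Finset.sum_le_sum fun a _ => ?_
  by_cases h0 : w a = 0
  · simp [h0]
  · exact mul_le_mul_of_nonneg_left (h a h0) (hw.nonneg a)

lemma sum_prod_fin (n : ℕ) (g : Fin n → A → ℝ) :
    ∑ c : Fin n → A, ∏ k, g k (c k) = ∏ k, ∑ a, g k a := by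
  rw [Finset.prod_univ_sum, Fintype.piFinset_univ]

lemma av_pw_prod_fin (w : A → ℝ) (n : ℕ) (g : Fin n → A → ℝ) :
    av (pw w n) (fun c => ∏ k, g k (c k)) = ∏ k, av w (g k) := by
  simp only [av, pw, ← Finset.prod_mul_distrib]
  exact sum_prod_fin n (fun k a => w a * g k a)

lemma kl_nonneg {J : A → ℝ} (hJ : IsP J) {r : A → ℝ} (hr : ∀ a, J a ≠ 0 → 0 < r a)
    (h : ∑ a, J a / r a ≤ 1) : 0 ≤ av J (fun a => Real.log (r a)) := by
  have h1 : ∑ a, (J a - J a / r a) ≤ av J (fun a => Real.log (r a)) := by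
    refine Finset.sum_le_sum fun a _ => ?_
    by_cases h0 : J a = 0
    · simp [h0]
    · have := Real.one_sub_inv_le_log_of_pos (hr a h0)
      have := mul_le_mul_of_nonneg_left this (hJ.nonneg a)
      rw [div_eq_mul_inv]; linarith
  rw [Finset.sum_sub_distrib, hJ.sum] at h1
  linarith

lemma chernoff {J : A → ℝ} (hJ : IsP J) (f : A → ℝ) {δ : ℝ} (hδ : 0 < δ) :
    ∃ s : ℝ, 0 ≤ s ∧ ∃ r : ℝ, 0 < r ∧
      av J (fun a => Real.exp (s * (f a - (av J f + δ)))) ≤ Real.exp (-r) := by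
  set g : A → ℝ := fun a => f a - (av J f + δ) with hg
  have hgm : av J g = -δ := by rw [hg, av_sub, av_const hJ]; ring
  obtain ⟨b, hb1, hb⟩ : ∃ b : ℝ, 1 ≤ b ∧ ∀ a, |g a| ≤ b := by
    refine ⟨1 + ∑ a, |g a|, ?_, fun a => ?_⟩
    · have : 0 ≤ ∑ a, |g a| := Finset.sum_nonneg fun a _ => abs_nonneg _
      linarith
    · have := Finset.single_le_sum (f := fun a => |g a|) (fun a _ => abs_nonneg _)
        (Finset.mem_univ a)
      linarith
  have hb0 : 0 < b := by linarith
  set s := min (1 / b) (δ / (2 * b ^ 2)) with hs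
  have hs0 : 0 < s := lt_min (by positivity) (by positivity)
  have hs1 : s * b ≤ 1 := by
    have : s ≤ 1 / b := min_le_left _ _
    rwa [le_div_iff₀ hb0] at this
  have hs2 : s * (2 * b ^ 2) ≤ δ := by
    have : s ≤ δ / (2 * b ^ 2) := min_le_right _ _
    rwa [le_div_iff₀ (by positivity)] at this
  refine ⟨s, hs0.le, s * δ / 2, by positivity, ?_⟩
  calc av J (fun a => Real.exp (s * g a))
      ≤ av J (fun a => (1 + (s * b) ^ 2) + s * g a) := by
        refine av_mono hJ fun a => ?_
        have hx : |s * g a| ≤ s * b := by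
          rw [abs_mul, abs_of_pos hs0]
          exact mul_le_mul_of_nonneg_left (hb a) hs0.le
        have := exp_le_quad (hx.trans hs1)
        have h3 : (s * g a) ^ 2 ≤ (s * b) ^ 2 := by
          rw [← sq_abs]
          exact pow_le_pow_left₀ (abs_nonneg _) hx 2
        linarith
    _ = 1 + (s * b) ^ 2 - s * δ := by rw [av_add, av_const hJ, av_mul, hgm]; ring
    _ ≤ 1 - s * δ / 2 := by nlinarith
    _ ≤ _ := by linarith [Real.add_one_le_exp (-(s * δ / 2))]

lemma prod_exp_ge {n : ℕ} {nu de : Fin n → ℝ} (hnu : ∀ k, 0 < nu k) (hde : ∀ k, 0 < de k)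
    {s c : ℝ} (hs : 0 ≤ s) (h : Real.exp (n * c) * ∏ k, de k < ∏ k, nu k) :
    1 ≤ ∏ k, Real.exp (s * (Real.log (nu k / de k) - c)) := by
  rw [← Real.exp_sum, ← Real.exp_zero]
  apply Real.exp_le_exp.2
  rw [← Finset.mul_sum]
  refine mul_nonneg hs ?_
  rw [Finset.sum_sub_distrib]
  simp only [Finset.sum_const, Finset.card_univ, Fintype.card_fin, nsmul_eq_mul]
  have hd : 0 < ∏ k, de k := Finset.prod_pos fun k _ => hde k
  have h1 : ∑ k, Real.log (nu k / de k) = Real.log (∏ k, nu k) - Real.log (∏ k, de k) := by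
    rw [Real.log_prod (fun k _ => (hnu k).ne'), Real.log_prod (fun k _ => (hde k).ne'),
      ← Finset.sum_sub_distrib]
    exact Finset.sum_congr rfl fun k _ => Real.log_div (hnu k).ne' (hde k).ne'
  have h2 := Real.log_lt_log (by positivity) h
  rw [Real.log_mul (Real.exp_pos _).ne' hd.ne', Real.log_exp] at h2
  rw [h1]; linarith

end letters

section channelPart

variable (P : Channel X Y Z)

/-- Joint distribution on the product alphabet. -/
def jt (w : X × Y × Z) : ℝ := P.joint w.1 w.2.1 w.2.2

lemma av_jt (f : X × Y × Z → ℝ) :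
    av (jt P) f = ∑ x, ∑ y, ∑ z, P.joint x y z * f (x, y, z) := by
  simp only [av, Fintype.sum_prod_type, jt]

lemma joint_nonneg (x : X) (y : Y) (z : Z) : 0 ≤ P.joint x y z :=
  mul_nonneg (mul_nonneg (P.qX_nonneg x) (P.qY_nonneg y)) (P.W_nonneg x y z)

lemma qX_isP : IsP P.qX := ⟨P.qX_nonneg, P.qX_sum_one⟩
lemma qY_isP : IsP P.qY := ⟨P.qY_nonneg, P.qY_sum_one⟩

lemma jt_isP : IsP (jt P) := by
  refine ⟨fun w => joint_nonneg P _ _ _, ?_⟩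
  simp only [Fintype.sum_prod_type, jt, Channel.joint, ← Finset.mul_sum, P.W_sum_one, mul_one,
    P.qY_sum_one, P.qX_sum_one]

lemma qZgX_eq (x : X) (z : Z) : P.qZgX x z = av P.qY (fun y => P.W x y z) := rfl
lemma qZgY_eq (y : Y) (z : Z) : P.qZgY y z = av P.qX (fun x => P.W x y z) := rfl

lemma qZ_eq1 (z : Z) : P.qZ z = ∑ x, P.qX x * P.qZgX x z := by
  simp only [Channel.qZ, Channel.joint, Channel.qZgX, Finset.mul_sum, mul_assoc]

lemma qZ_eq2 (z : Z) : P.qZ z = ∑ y, P.qY y * P.qZgY y z := by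
  simp only [Channel.qZ, Channel.joint, Channel.qZgY, Finset.mul_sum]
  rw [Finset.sum_comm]
  exact Finset.sum_congr rfl fun _ _ => Finset.sum_congr rfl fun _ _ => by ring

lemma qZgX_nonneg (x : X) (z : Z) : 0 ≤ P.qZgX x z :=
  Finset.sum_nonneg fun y _ => mul_nonneg (P.qY_nonneg y) (P.W_nonneg x y z)
lemma qZgY_nonneg (y : Y) (z : Z) : 0 ≤ P.qZgY y z :=
  Finset.sum_nonneg fun x _ => mul_nonneg (P.qX_nonneg x) (P.W_nonneg x y z)
lemma qZ_nonneg (z : Z) : 0 ≤ P.qZ z :=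
  Finset.sum_nonneg fun x _ => Finset.sum_nonneg fun y _ => joint_nonneg P x y z

lemma qZ_sum : ∑ z, P.qZ z = 1 := by
  have := (jt_isP P).sum
  rw [Fintype.sum_prod_type] at this
  simp only [Fintype.sum_prod_type, jt] at this
  rw [← this]
  simp only [Channel.qZ]
  rw [Finset.sum_comm]
  exact Finset.sum_congr rfl fun x _ => Finset.sum_comm

lemma pos_of_joint {x : X} {y : Y} {z : Z} (h : P.joint x y z ≠ 0) :
    0 < P.qX x ∧ 0 < P.qY y ∧ 0 < P.W x y z ∧ 0 < P.qZgX x z ∧ 0 < P.qZgY y z ∧ 0 < P.qZ z := by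
  have hx : P.qX x ≠ 0 := fun h0 => h (by simp [Channel.joint, h0])
  have hy : P.qY y ≠ 0 := fun h0 => h (by simp [Channel.joint, h0])
  have hw : P.W x y z ≠ 0 := fun h0 => h (by simp [Channel.joint, h0])
  have hxpos := lt_of_le_of_ne (P.qX_nonneg x) hx.symm
  have hypos := lt_of_le_of_ne (P.qY_nonneg y) hy.symm
  have hwpos := lt_of_le_of_ne (P.W_nonneg x y z) hw.symm
  have hzx : 0 < P.qZgX x z :=
    Finset.sum_pos' (fun y _ => mul_nonneg (P.qY_nonneg y) (P.W_nonneg x y z))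
      ⟨y, Finset.mem_univ _, mul_pos hypos hwpos⟩
  have hzy : 0 < P.qZgY y z :=
    Finset.sum_pos' (fun x _ => mul_nonneg (P.qX_nonneg x) (P.W_nonneg x y z))
      ⟨x, Finset.mem_univ _, mul_pos hxpos hwpos⟩
  refine ⟨hxpos, hypos, hwpos, hzx, hzy, ?_⟩
  rw [qZ_eq1]
  exact Finset.sum_pos' (fun x _ => mul_nonneg (P.qX_nonneg x) (qZgX_nonneg P x z))
      ⟨x, Finset.mem_univ _, mul_pos hxpos hzx⟩

/-- `I(X,Y;Z)`. -/
def IXY : ℝ := av (jt P) (fun w => Real.log (P.W w.1 w.2.1 w.2.2 / P.qZ w.2.2))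

lemma IXZ_eq : P.IXZ = av (jt P) (fun w => Real.log (P.qZgX w.1 w.2.2 / P.qZ w.2.2)) := by
  rw [av_jt]; rfl
lemma IYZ_eq : P.IYZ = av (jt P) (fun w => Real.log (P.qZgY w.2.1 w.2.2 / P.qZ w.2.2)) := by
  rw [av_jt]; rfl
lemma IXZgY_eq : P.IXZgY =
    av (jt P) (fun w => Real.log (P.W w.1 w.2.1 w.2.2 / P.qZgY w.2.1 w.2.2)) := by
  rw [av_jt]; rfl
lemma IYZgX_eq : P.IYZgX =
    av (jt P) (fun w => Real.log (P.W w.1 w.2.1 w.2.2 / P.qZgX w.1 w.2.2)) := by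
  rw [av_jt]; rfl

lemma av_congr_supp {A : Type} [Fintype A] {w f g : A → ℝ} (h : ∀ a, w a ≠ 0 → f a = g a) :
    av w f = av w g := by
  refine Finset.sum_congr rfl fun a _ => ?_
  by_cases h0 : w a = 0
  · simp [h0]
  · rw [h a h0]

lemma chain1 : P.IXZ + P.IYZgX = IXY P := by
  rw [IXZ_eq, IYZgX_eq, IXY, ← av_add]
  refine av_congr_supp fun w hw => ?_
  obtain ⟨_, _, h1, h2, h3, h4⟩ := pos_of_joint P hw
  rw [Real.log_div h2.ne' h4.ne', Real.log_div h1.ne' h2.ne', Real.log_div h1.ne' h4.ne']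
  ring

lemma chain2 : P.IYZ + P.IXZgY = IXY P := by
  rw [IYZ_eq, IXZgY_eq, IXY, ← av_add]
  refine av_congr_supp fun w hw => ?_
  obtain ⟨_, _, h1, h2, h3, h4⟩ := pos_of_joint P hw
  rw [Real.log_div h3.ne' h4.ne', Real.log_div h1.ne' h3.ne', Real.log_div h1.ne' h4.ne']
  ring

lemma sum_jt (g : X → Y → Z → ℝ) :
    ∑ w : X × Y × Z, g w.1 w.2.1 w.2.2 = ∑ x, ∑ y, ∑ z, g x y z := by
  simp only [Fintype.sum_prod_type]

lemma mul_div_le {a b : ℝ} (hb : 0 ≤ b) : a * (b / a) ≤ b := by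
  by_cases h : a = 0
  · simp [h, hb]
  · rw [mul_div_cancel₀ _ h]

lemma IXZ_nonneg : 0 ≤ P.IXZ := by
  rw [IXZ_eq]
  refine kl_nonneg (jt_isP P) (fun w hw => ?_) ?_
  · obtain ⟨_, _, h1, h2, h3, h4⟩ := pos_of_joint P hw
    positivity
  · have e := sum_jt (fun x y z => P.joint x y z / (P.qZgX x z / P.qZ z))
    simp only [jt]
    rw [e]
    calc ∑ x, ∑ y, ∑ z, P.joint x y z / (P.qZgX x z / P.qZ z)
        = ∑ x, ∑ z, P.qX x * (P.qZgX x z * (P.qZ z / P.qZgX x z)) := by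
          refine Finset.sum_congr rfl fun x _ => ?_
          rw [Finset.sum_comm]
          refine Finset.sum_congr rfl fun z _ => ?_
          nth_rewrite 2 [Channel.qZgX]
          rw [Finset.sum_mul, Finset.mul_sum]
          refine Finset.sum_congr rfl fun y _ => ?_
          rw [Channel.joint, div_div_eq_mul_div]; ring
      _ ≤ ∑ x, ∑ z, P.qX x * P.qZ z := by
          refine Finset.sum_le_sum fun x _ => Finset.sum_le_sum fun z _ => ?_
          exact mul_le_mul_of_nonneg_left (mul_div_le (qZ_nonneg P z)) (P.qX_nonneg x)
      _ = 1 := by simp only [← Finset.mul_sum, qZ_sum, mul_one, P.qX_sum_one]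

lemma IYZ_nonneg : 0 ≤ P.IYZ := by
  rw [IYZ_eq]
  refine kl_nonneg (jt_isP P) (fun w hw => ?_) ?_
  · obtain ⟨_, _, h1, h2, h3, h4⟩ := pos_of_joint P hw
    positivity
  · have e := sum_jt (fun x y z => P.joint x y z / (P.qZgY y z / P.qZ z))
    simp only [jt]
    rw [e, Finset.sum_comm]
    calc ∑ y, ∑ x, ∑ z, P.joint x y z / (P.qZgY y z / P.qZ z)
        = ∑ y, ∑ z, P.qY y * (P.qZgY y z * (P.qZ z / P.qZgY y z)) := by
          refine Finset.sum_congr rfl fun y _ => ?_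
          rw [Finset.sum_comm]
          refine Finset.sum_congr rfl fun z _ => ?_
          nth_rewrite 2 [Channel.qZgY]
          rw [Finset.sum_mul, Finset.mul_sum]
          refine Finset.sum_congr rfl fun x _ => ?_
          rw [Channel.joint, div_div_eq_mul_div]; ring
      _ ≤ ∑ y, ∑ z, P.qY y * P.qZ z := by
          refine Finset.sum_le_sum fun y _ => Finset.sum_le_sum fun z _ => ?_
          exact mul_le_mul_of_nonneg_left (mul_div_le (qZ_nonneg P z)) (P.qY_nonneg y)
      _ = 1 := by simp only [← Finset.mul_sum, qZ_sum, mul_one, P.qY_sum_one]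

lemma IXZ_le : P.IXZ ≤ P.IXZgY := by
  have key : 0 ≤ av (jt P) (fun w => Real.log (P.W w.1 w.2.1 w.2.2 * P.qZ w.2.2 /
      (P.qZgX w.1 w.2.2 * P.qZgY w.2.1 w.2.2))) := by
    refine kl_nonneg (jt_isP P) (fun w hw => ?_) ?_
    · obtain ⟨_, _, h1, h2, h3, h4⟩ := pos_of_joint P hw
      positivity
    · have e := sum_jt (fun x y z => P.joint x y z /
        (P.W x y z * P.qZ z / (P.qZgX x z * P.qZgY y z)))
      simp only [jt]
      rw [e]
      calc ∑ x, ∑ y, ∑ z, P.joint x y z / (P.W x y z * P.qZ z / (P.qZgX x z * P.qZgY y z))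
          ≤ ∑ x, ∑ y, ∑ z, (P.qX x * P.qZgX x z) * ((P.qY y * P.qZgY y z) / P.qZ z) := by
            refine Finset.sum_le_sum fun x _ => Finset.sum_le_sum fun y _ =>
              Finset.sum_le_sum fun z _ => ?_
            have hn : 0 ≤ (P.qX x * P.qZgX x z) * ((P.qY y * P.qZgY y z) / P.qZ z) :=
              mul_nonneg (mul_nonneg (P.qX_nonneg x) (qZgX_nonneg P x z))
                (div_nonneg (mul_nonneg (P.qY_nonneg y) (qZgY_nonneg P y z)) (qZ_nonneg P z))
            by_cases hj : P.joint x y z = 0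
            · rw [hj, zero_div]; exact hn
            · obtain ⟨_, _, h1, h2, h3, h4⟩ := pos_of_joint P hj
              apply le_of_eq
              rw [Channel.joint]
              field_simp
        _ = ∑ z, ∑ x, ∑ y, (P.qX x * P.qZgX x z) * ((P.qY y * P.qZgY y z) / P.qZ z) := by
            rw [Finset.sum_comm]
            rw [Finset.sum_comm]
            rw [Finset.sum_congr rfl (fun x _ => Finset.sum_comm)]
            rw [Finset.sum_comm]
        _ = ∑ z, P.qZ z * (P.qZ z / P.qZ z) := by
            refine Finset.sum_congr rfl fun z _ => ?_
            simp only [← Finset.mul_sum, ← Finset.sum_mul, ← Finset.sum_div, ← qZ_eq1, ← qZ_eq2]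
        _ ≤ ∑ z, P.qZ z := Finset.sum_le_sum fun z _ => mul_div_le (qZ_nonneg P z)
        _ = 1 := qZ_sum P
  have e : av (jt P) (fun w => Real.log (P.W w.1 w.2.1 w.2.2 * P.qZ w.2.2 /
      (P.qZgX w.1 w.2.2 * P.qZgY w.2.1 w.2.2))) = P.IXZgY - P.IXZ := by
    rw [IXZ_eq, IXZgY_eq, ← av_sub]
    refine av_congr_supp fun w hw => ?_
    obtain ⟨_, _, h1, h2, h3, h4⟩ := pos_of_joint P hw
    rw [Real.log_div (by positivity) (by positivity), Real.log_mul h1.ne' h4.ne',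
      Real.log_mul h2.ne' h3.ne', Real.log_div h1.ne' h3.ne', Real.log_div h2.ne' h4.ne']
    ring
  linarith

lemma region {R1 R2 : ℝ} (hmem : (R1, R2) ∈ interior (closure (convexHull ℝ
      {p : ℝ × ℝ | (p.1 ≥ P.IXZgY ∧ p.2 ≥ P.IYZ) ∨ (p.1 ≥ P.IXZ ∧ p.2 ≥ P.IYZgX)}))) :
    P.IXZ < R1 ∧ P.IYZ < R2 ∧ IXY P < R1 + R2 := by
  set H : Set (ℝ × ℝ) := {p | P.IXZ ≤ p.1} ∩ ({p | P.IYZ ≤ p.2} ∩ {p | IXY P ≤ p.1 + p.2}) with hH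
  have hcl : IsClosed H := by
    refine IsClosed.inter ?_ (IsClosed.inter ?_ ?_)
    · exact isClosed_le continuous_const continuous_fst
    · exact isClosed_le continuous_const continuous_snd
    · exact isClosed_le continuous_const (continuous_fst.add continuous_snd)
  have hcv : Convex ℝ H := by
    intro p hp q hq a b ha hb hab
    obtain ⟨p1, p2, p3⟩ := hp
    obtain ⟨q1, q2, q3⟩ := hq
    simp only [Set.mem_ofPred_eq] at p1 p2 p3 q1 q2 q3
    obtain rfl : b = 1 - a := by linarith
    refine ⟨?_, ?_, ?_⟩ <;>
      simp only [Set.mem_ofPred_eq, Prod.fst_add, Prod.snd_add, Prod.smul_fst, Prod.smul_snd,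
        smul_eq_mul] <;> nlinarith
  have c1 := chain1 P
  have c2 := chain2 P
  have le1 := IXZ_le P
  have hsub : closure (convexHull ℝ
      {p : ℝ × ℝ | (p.1 ≥ P.IXZgY ∧ p.2 ≥ P.IYZ) ∨ (p.1 ≥ P.IXZ ∧ p.2 ≥ P.IYZgX)}) ⊆ H := by
    refine closure_minimal (convexHull_min ?_ hcv) hcl
    rintro p (⟨h1, h2⟩ | ⟨h1, h2⟩)
    · exact ⟨show P.IXZ ≤ p.1 by linarith, show P.IYZ ≤ p.2 by linarith,
        show IXY P ≤ p.1 + p.2 by linarith⟩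
    · exact ⟨show P.IXZ ≤ p.1 by linarith, show P.IYZ ≤ p.2 by linarith,
        show IXY P ≤ p.1 + p.2 by linarith⟩
  have hn : H ∈ nhds (R1, R2) := Filter.mem_of_superset (mem_interior_iff_mem_nhds.1 hmem) hsub
  obtain ⟨ε, hε, hball⟩ := Metric.mem_nhds_iff.1 hn
  have hm : (R1 - ε / 2, R2 - ε / 2) ∈ H := by
    apply hball
    rw [Metric.mem_ball, Prod.dist_eq, Real.dist_eq, Real.dist_eq]
    simp only [sub_sub_cancel_left, abs_neg, max_self, abs_of_pos (half_pos hε)]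
    linarith
  obtain ⟨h1, h2, h3⟩ := hm
  simp only [Set.mem_ofPred_eq] at h1 h2 h3
  exact ⟨by linarith, by linarith, by linarith⟩

end channelPart

section blockPart

variable (P : Channel X Y Z)

lemma Wn_nonneg (n : ℕ) (a : Fin n → X) (b : Fin n → Y) (z : Fin n → Z) : 0 ≤ P.Wn n a b z :=
  Finset.prod_nonneg fun k _ => P.W_nonneg _ _ _

lemma Wn_sum (n : ℕ) (a : Fin n → X) (b : Fin n → Y) : ∑ z, P.Wn n a b z = 1 := by
  simp only [Channel.Wn]
  rw [sum_prod_fin n (fun k z => P.W (a k) (b k) z)]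
  simp only [P.W_sum_one, Finset.prod_const_one]

lemma Wn_avY (n : ℕ) (a : Fin n → X) (z : Fin n → Z) :
    av (pw P.qY n) (fun b => P.Wn n a b z) = ∏ k, P.qZgX (a k) (z k) :=
  av_pw_prod_fin P.qY n (fun k y => P.W (a k) y (z k))

lemma Wn_avX (n : ℕ) (b : Fin n → Y) (z : Fin n → Z) :
    av (pw P.qX n) (fun a => P.Wn n a b z) = ∏ k, P.qZgY (b k) (z k) :=
  av_pw_prod_fin P.qX n (fun k x => P.W x (b k) (z k))

lemma qZn_eq (n : ℕ) (z : Fin n → Z) :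
    P.qZn n z = av (pw P.qX n) (fun a => av (pw P.qY n) (fun b => P.Wn n a b z)) := by
  simp only [Wn_avY]
  rw [av_pw_prod_fin P.qX n (fun k x => P.qZgX x (z k))]
  simp only [Channel.qZn, qZ_eq1, av]

lemma letter_pow (n : ℕ) (φ : X × Y × Z → ℝ) :
    av (pw P.qX n) (fun a => av (pw P.qY n) (fun b => ∑ z, P.Wn n a b z *
      ∏ k, φ (a k, b k, z k))) = (av (jt P) φ) ^ n := by
  simp only [Channel.Wn, ← Finset.prod_mul_distrib]
  have h1 : ∀ (a : Fin n → X) (b : Fin n → Y),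
      ∑ z : Fin n → Z, ∏ k, P.W (a k) (b k) (z k) * φ (a k, b k, z k) =
      ∏ k, ∑ z, P.W (a k) (b k) z * φ (a k, b k, z) := fun a b =>
    sum_prod_fin n (fun k z => P.W (a k) (b k) z * φ (a k, b k, z))
  simp only [h1]
  have h2 : ∀ (a : Fin n → X), av (pw P.qY n) (fun b =>
      ∏ k, ∑ z, P.W (a k) (b k) z * φ (a k, b k, z)) =
      ∏ k, av P.qY (fun y => ∑ z, P.W (a k) y z * φ (a k, y, z)) := fun a =>
    av_pw_prod_fin P.qY n (fun k y => ∑ z, P.W (a k) y z * φ (a k, y, z))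
  simp only [h2]
  rw [av_pw_prod_fin P.qX n (fun _ x => av P.qY (fun y => ∑ z, P.W x y z * φ (x, y, z)))]
  rw [Finset.prod_const, Finset.card_univ, Fintype.card_fin, av_jt]
  congr 1
  simp only [av, Finset.mul_sum, Channel.joint]
  exact Finset.sum_congr rfl fun _ _ => Finset.sum_congr rfl fun _ _ =>
    Finset.sum_congr rfl fun _ _ => by ring

/-- Jointly typical triples. -/
def typ (δ : ℝ) (n : ℕ) (a : Fin n → X) (b : Fin n → Y) (z : Fin n → Z) : Prop :=
  P.Wn n a b z ≤ Real.exp (n * (IXY P + δ)) * P.qZn n z ∧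
  ∏ k, P.qZgX (a k) (z k) ≤ Real.exp (n * (P.IXZ + δ)) * P.qZn n z ∧
  ∏ k, P.qZgY (b k) (z k) ≤ Real.exp (n * (P.IYZ + δ)) * P.qZn n z

lemma atyp {δ : ℝ} (hδ : 0 < δ) : ∃ r : ℝ, 0 < r ∧ ∀ n : ℕ,
    av (pw P.qX n) (fun a => av (pw P.qY n) (fun b => ∑ z, P.Wn n a b z *
      (if typ P δ n a b z then 0 else 1))) ≤ 3 * Real.exp (-(n * r)) := by
  have hJ := jt_isP P
  obtain ⟨s1, hs1, r1, hr1, h1⟩ := chernoff hJ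
    (fun w => Real.log (P.W w.1 w.2.1 w.2.2 / P.qZ w.2.2)) hδ
  obtain ⟨s2, hs2, r2, hr2, h2⟩ := chernoff hJ
    (fun w => Real.log (P.qZgX w.1 w.2.2 / P.qZ w.2.2)) hδ
  obtain ⟨s3, hs3, r3, hr3, h3⟩ := chernoff hJ
    (fun w => Real.log (P.qZgY w.2.1 w.2.2 / P.qZ w.2.2)) hδ
  rw [← IXY] at h1
  rw [← IXZ_eq] at h2
  rw [← IYZ_eq] at h3
  set φ1 : X × Y × Z → ℝ := fun w =>
    Real.exp (s1 * (Real.log (P.W w.1 w.2.1 w.2.2 / P.qZ w.2.2) - (IXY P + δ))) with hφ1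
  set φ2 : X × Y × Z → ℝ := fun w =>
    Real.exp (s2 * (Real.log (P.qZgX w.1 w.2.2 / P.qZ w.2.2) - (P.IXZ + δ))) with hφ2
  set φ3 : X × Y × Z → ℝ := fun w =>
    Real.exp (s3 * (Real.log (P.qZgY w.2.1 w.2.2 / P.qZ w.2.2) - (P.IYZ + δ))) with hφ3
  set r := min r1 (min r2 r3) with hr
  have hr0 : 0 < r := lt_min hr1 (lt_min hr2 hr3)
  refine ⟨r, hr0, fun n => ?_⟩
  have hu := pw_isP (qX_isP P) n
  have hv := pw_isP (qY_isP P) n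
  have step : av (pw P.qX n) (fun a => av (pw P.qY n) (fun b => ∑ z, P.Wn n a b z *
      (if typ P δ n a b z then 0 else 1))) ≤
      av (pw P.qX n) (fun a => av (pw P.qY n) (fun b =>
        ∑ z, P.Wn n a b z * ∏ k, φ1 (a k, b k, z k) +
        (∑ z, P.Wn n a b z * ∏ k, φ2 (a k, b k, z k) +
        ∑ z, P.Wn n a b z * ∏ k, φ3 (a k, b k, z k)))) := by
    refine av_mono_supp hu fun a ha => av_mono_supp hv fun b hb => ?_
    rw [← Finset.sum_add_distrib, ← Finset.sum_add_distrib]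
    refine Finset.sum_le_sum fun z _ => ?_
    rw [← mul_add, ← mul_add]
    by_cases hW : P.Wn n a b z = 0
    · simp [hW]
    refine mul_le_mul_of_nonneg_left ?_ (Wn_nonneg P n a b z)
    have p1 : 0 ≤ ∏ k, φ1 (a k, b k, z k) := Finset.prod_nonneg fun k _ => (Real.exp_pos _).le
    have p2 : 0 ≤ ∏ k, φ2 (a k, b k, z k) := Finset.prod_nonneg fun k _ => (Real.exp_pos _).le
    have p3 : 0 ≤ ∏ k, φ3 (a k, b k, z k) := Finset.prod_nonneg fun k _ => (Real.exp_pos _).le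
    by_cases hT : typ P δ n a b z
    · rw [if_pos hT]; positivity
    rw [if_neg hT]
    have hj : ∀ k, P.joint (a k) (b k) (z k) ≠ 0 := by
      intro k
      refine mul_ne_zero (mul_ne_zero ?_ ?_) ?_
      · exact Finset.prod_ne_zero_iff.1 ha k (Finset.mem_univ k)
      · exact Finset.prod_ne_zero_iff.1 hb k (Finset.mem_univ k)
      · exact Finset.prod_ne_zero_iff.1 hW k (Finset.mem_univ k)
    have hpos := fun k => pos_of_joint P (hj k)
    by_cases t1 : P.Wn n a b z ≤ Real.exp (n * (IXY P + δ)) * P.qZn n z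
    · by_cases t2 : ∏ k, P.qZgX (a k) (z k) ≤ Real.exp (n * (P.IXZ + δ)) * P.qZn n z
      · by_cases t3 : ∏ k, P.qZgY (b k) (z k) ≤ Real.exp (n * (P.IYZ + δ)) * P.qZn n z
        · exact absurd ⟨t1, t2, t3⟩ hT
        · have : 1 ≤ ∏ k, φ3 (a k, b k, z k) :=
            prod_exp_ge (fun k => (hpos k).2.2.2.2.1) (fun k => (hpos k).2.2.2.2.2) hs3
              (not_le.1 t3)
          linarith
      · have : 1 ≤ ∏ k, φ2 (a k, b k, z k) :=
          prod_exp_ge (fun k => (hpos k).2.2.2.1) (fun k => (hpos k).2.2.2.2.2) hs2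
            (not_le.1 t2)
        linarith
    · have : 1 ≤ ∏ k, φ1 (a k, b k, z k) :=
        prod_exp_ge (fun k => (hpos k).2.2.1) (fun k => (hpos k).2.2.2.2.2) hs1
          (not_le.1 t1)
      linarith
  refine step.trans ?_
  simp only [av_add, letter_pow]
  have pb : ∀ (φ : X × Y × Z → ℝ) (r' : ℝ), (∀ w, 0 ≤ φ w) → r ≤ r' →
      av (jt P) φ ≤ Real.exp (-r') → (av (jt P) φ) ^ n ≤ Real.exp (-(n * r)) := by
    intro φ r' h0 hrr h
    calc (av (jt P) φ) ^ n ≤ (Real.exp (-r)) ^ n :=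
          pow_le_pow_left₀ (av_nonneg hJ h0) (h.trans (Real.exp_le_exp.2 (by linarith))) n
      _ = _ := by rw [← Real.exp_nat_mul]; congr 1; ring
  have q1 := pb φ1 r1 (fun w => (Real.exp_pos _).le) (min_le_left _ _) h1
  have q2 := pb φ2 r2 (fun w => (Real.exp_pos _).le)
    ((min_le_right _ _).trans (min_le_left _ _)) h2
  have q3 := pb φ3 r3 (fun w => (Real.exp_pos _).le)
    ((min_le_right _ _).trans (min_le_right _ _)) h3
  linarith

lemma cbP2_eq (n M1 M2 : ℕ) (E : (Fin M1 → Fin n → X) → (Fin M2 → Fin n → Y) → Prop) :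
    P.cbP2 n M1 M2 E = av (pw (pw P.qX n) M1) (fun C1 => av (pw (pw P.qY n) M2) (fun C2 =>
      if E C1 C2 then 1 else 0)) := by
  simp only [Channel.cbP2, av, pw, Finset.mul_sum, mul_assoc]

lemma numCw_bounds (n : ℕ) {R : ℝ} (hR : 0 < R) :
    Real.exp (n * R) ≤ numCw n R ∧ (numCw n R : ℝ) ≤ Real.exp (n * R) + 1 :=
  ⟨Nat.le_ceil _, (Nat.ceil_lt_add_one (Real.exp_pos _).le).le⟩

/-- Bound on the expected variational distance. -/
lemma ex_tv {R1 R2 δ r ρ : ℝ} (hδ : 0 < δ) (hρ : 0 < ρ) (hρ1 : ρ ≤ R1) (hρ2 : ρ ≤ R2)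
    (h1 : P.IXZ + 2 * δ ≤ R1) (h2 : P.IYZ + 2 * δ ≤ R2) (h12 : IXY P + 2 * δ ≤ R1 + R2) (n : ℕ)
    (hat : av (pw P.qX n) (fun a => av (pw P.qY n) (fun b => ∑ z, P.Wn n a b z *
      (if typ P δ n a b z then 0 else 1))) ≤ 3 * Real.exp (-(n * r))) :
    av (pw (pw P.qX n) (numCw n R1)) (fun C1 => av (pw (pw P.qY n) (numCw n R2)) (fun C2 =>
      tvDist (outp (Real.exp (-((n : ℝ) * (R1 + R2)))) (P.Wn n) C1 C2) (P.qZn n))) ≤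
      (5 * Real.exp (-(n * (δ / 2))) + 24 * Real.exp (-(n * r)) + 3 * Real.exp (-(n * ρ))) / 2 := by
  have hn : (0 : ℝ) ≤ n := Nat.cast_nonneg n
  set a1 := Real.exp (n * R1) with ha1
  set a2 := Real.exp (n * R2) with ha2
  have ha1p : 1 ≤ a1 := Real.one_le_exp (mul_nonneg hn (by linarith))
  have ha2p : 1 ≤ a2 := Real.one_le_exp (mul_nonneg hn (by linarith))
  obtain ⟨l1, g1⟩ := numCw_bounds n (show 0 < R1 by linarith)
  obtain ⟨l2, g2⟩ := numCw_bounds n (show 0 < R2 by linarith)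
  rw [← ha1] at l1 g1
  rw [← ha2] at l2 g2
  set M1 := numCw n R1
  set M2 := numCw n R2
  set L := Real.exp (-((n : ℝ) * (R1 + R2))) with hL
  have hLa : L = (a1 * a2)⁻¹ := by
    rw [hL, ha1, ha2, ← Real.exp_add, ← Real.exp_neg]; congr 1; ring
  have hL0 : 0 ≤ L := (Real.exp_pos _).le
  have hLaa : L * (a1 * a2) = 1 := by
    rw [hLa]; exact inv_mul_cancel₀ (by positivity)
  have hε : L ^ 2 * (M1 * M2 * Real.exp (n * (IXY P + δ)) + M1 ^ 2 * M2 * Real.exp (n * (P.IYZ + δ))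
      + M1 * M2 ^ 2 * Real.exp (n * (P.IXZ + δ))) ≤ (5 * Real.exp (-(n * (δ / 2)))) ^ 2 := by
    set d := Real.exp (-(n * δ)) with hd
    have hd0 : 0 < d := Real.exp_pos _
    have e12 : Real.exp (n * (IXY P + δ)) ≤ a1 * a2 * d := by
      rw [ha1, ha2, hd, ← Real.exp_add, ← Real.exp_add]
      apply Real.exp_le_exp.2; nlinarith
    have e1 : Real.exp (n * (P.IXZ + δ)) ≤ a1 * d := by
      rw [ha1, hd, ← Real.exp_add]
      apply Real.exp_le_exp.2; nlinarith
    have e2 : Real.exp (n * (P.IYZ + δ)) ≤ a2 * d := by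
      rw [ha2, hd, ← Real.exp_add]
      apply Real.exp_le_exp.2; nlinarith
    have g1' : (M1 : ℝ) ≤ 2 * a1 := by linarith
    have g2' : (M2 : ℝ) ≤ 2 * a2 := by linarith
    calc _ ≤ L ^ 2 * ((2 * a1) * (2 * a2) * (a1 * a2 * d) + (2 * a1) ^ 2 * (2 * a2) * (a2 * d)
            + (2 * a1) * (2 * a2) ^ 2 * (a1 * d)) := by gcongr
      _ = (L * (a1 * a2)) ^ 2 * (20 * d) := by ring
      _ = 20 * d := by rw [hLaa]; ring
      _ ≤ 25 * d := by linarith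
      _ = _ := by
        rw [mul_pow, ← Real.exp_nat_mul, hd]; norm_num; ring
  have main := oneShot (pw_isP (qX_isP P) n) (pw_isP (qY_isP P) n) (Wn_nonneg P n) (Wn_sum P n)
    (qZn_eq P n) (typ P δ n) (Real.exp_pos (n * (IXY P + δ))).le
    (Real.exp_pos (n * (P.IXZ + δ))).le (Real.exp_pos (n * (P.IYZ + δ))).le
    (fun a b z h => h.1) (fun a b z h => (Wn_avY P n a z).trans_le h.2.1)
    (fun a b z h => (Wn_avX P n b z).trans_le h.2.2) hL0 M1 M2
    (by positivity : 0 ≤ 5 * Real.exp (-(n * (δ / 2)))) hε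
  have hκ4 : L * (M1 * M2) ≤ 4 := by
    calc L * (M1 * M2) ≤ L * ((2 * a1) * (2 * a2)) := by gcongr <;> linarith
      _ = 4 * (L * (a1 * a2)) := by ring
      _ = 4 := by rw [hLaa]; ring
  have hκ : |L * (M1 * M2) - 1| ≤ 3 * Real.exp (-(n * ρ)) := by
    have hlow : 1 ≤ L * (M1 * M2) := by
      rw [← hLaa]; gcongr
    have hup : L * (M1 * M2) ≤ L * ((a1 + 1) * (a2 + 1)) := by gcongr
    have hi1 : L * a2 = Real.exp (-(n * R1)) := by
      rw [hL, ha2, ← Real.exp_add]; congr 1; ring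
    have hi2 : L * a1 = Real.exp (-(n * R2)) := by
      rw [hL, ha1, ← Real.exp_add]; congr 1; ring
    have j1 : Real.exp (-(n * R1)) ≤ Real.exp (-(n * ρ)) := by
      apply Real.exp_le_exp.2; nlinarith
    have j2 : Real.exp (-(n * R2)) ≤ Real.exp (-(n * ρ)) := by
      apply Real.exp_le_exp.2; nlinarith
    have j3 : L ≤ L * a1 := le_mul_of_one_le_right hL0 ha1p
    rw [abs_of_nonneg (by linarith)]
    have : L * ((a1 + 1) * (a2 + 1)) = L * (a1 * a2) + L * a1 + L * a2 + L := by ring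
    linarith
  simp only [tvDist, av_mul]
  have hat0 : 0 ≤ av (pw P.qX n) (fun a => av (pw P.qY n) (fun b => ∑ z, P.Wn n a b z *
      (if typ P δ n a b z then 0 else 1))) := by
    refine av_nonneg (pw_isP (qX_isP P) n) fun a => av_nonneg (pw_isP (qY_isP P) n) fun b =>
      Finset.sum_nonneg fun z _ => mul_nonneg (Wn_nonneg P n a b z) ?_
    split_ifs <;> norm_num
  have hprod : 2 * (L * (M1 * M2)) * av (pw P.qX n) (fun a => av (pw P.qY n) (fun b =>
      ∑ z, P.Wn n a b z * (if typ P δ n a b z then 0 else 1))) ≤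
      (2 * 4) * (3 * Real.exp (-(n * r))) := by gcongr
  linarith

end blockPart


/-- Corollary to Theorem 3: the doubly-exponential resolvability bound
holds for every rate pair in the interior of the convex closure of the union of the two
corner regions. -/
theorem statement1 {X Y Z : Type} [Fintype X] [Fintype Y] [Fintype Z]
    (P : Channel X Y Z) (R1 R2 : ℝ)
    (hmem : (R1, R2) ∈ interior (closure (convexHull ℝ
      {p : ℝ × ℝ | (p.1 ≥ P.IXZgY ∧ p.2 ≥ P.IYZ) ∨ (p.1 ≥ P.IXZ ∧ p.2 ≥ P.IYZgX)}))) :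
    ∃ γ1 > (0 : ℝ), ∃ γ2 > (0 : ℝ), ∃ N : ℕ, ∀ n ≥ N,
      P.cbP2 n (numCw n R1) (numCw n R2) (fun C1 C2 =>
          tvDist (fun zs => P.pOut n R1 R2 C1 C2 zs) (fun zs => P.qZn n zs) >
            Real.exp (-(γ1 * (n : ℝ))))
        ≤ Real.exp (-Real.exp (γ2 * (n : ℝ))) := by
  obtain ⟨h1, h2, h12⟩ := region P hmem
  have hI1 := IXZ_nonneg P
  have hI2 := IYZ_nonneg P
  set δ := min (R1 - P.IXZ) (min (R2 - P.IYZ) (R1 + R2 - IXY P)) / 2 with hδd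
  have hδ : 0 < δ := by
    have : 0 < min (R1 - P.IXZ) (min (R2 - P.IYZ) (R1 + R2 - IXY P)) :=
      lt_min (by linarith) (lt_min (by linarith) (by linarith))
    linarith
  have d1 : 2 * δ ≤ R1 - P.IXZ := by
    have := min_le_left (R1 - P.IXZ) (min (R2 - P.IYZ) (R1 + R2 - IXY P))
    linarith
  have d2 : 2 * δ ≤ R2 - P.IYZ := by
    have := (min_le_right (R1 - P.IXZ) (min (R2 - P.IYZ) (R1 + R2 - IXY P))).trans
      (min_le_left _ _)
    linarith
  have d3 : 2 * δ ≤ R1 + R2 - IXY P := by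
    have := (min_le_right (R1 - P.IXZ) (min (R2 - P.IYZ) (R1 + R2 - IXY P))).trans
      (min_le_right _ _)
    linarith
  obtain ⟨r, hr, hat⟩ := atyp P hδ
  set ρ := min R1 R2 with hρd
  have hρ : 0 < ρ := lt_min (by linarith) (by linarith)
  have hρ1 : ρ ≤ R1 := min_le_left _ _
  have hρ2 : ρ ≤ R2 := min_le_right _ _
  set β := min (δ / 2) (min r (ρ / 2)) with hβd
  have hβ : 0 < β := lt_min (by linarith) (lt_min hr (by linarith))
  have hβ1 : β ≤ δ / 2 := min_le_left _ _
  have hβ2 : β ≤ r := (min_le_right _ _).trans (min_le_left _ _)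
  have hβ3 : β ≤ ρ / 2 := (min_le_right _ _).trans (min_le_right _ _)
  refine ⟨β / 2, by linarith, ρ / 8, by linarith, ⌈64 / β⌉₊, fun n hnN => ?_⟩
  have hn : (0 : ℝ) ≤ n := Nat.cast_nonneg n
  have hnβ : 64 ≤ n * β := by
    have := (Nat.le_ceil (64 / β)).trans (Nat.cast_le.2 hnN : _ ≤ (n : ℝ))
    rwa [div_le_iff₀ hβ] at this
  have hetv := ex_tv P hδ hρ hρ1 hρ2 (by linarith) (by linarith) (by linarith) n (hat n)
  rw [cbP2_eq]
  change av (pw (pw P.qX n) (numCw n R1)) (fun C1 => av (pw (pw P.qY n) (numCw n R2)) (fun C2 =>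
      if tvDist (outp (Real.exp (-((n : ℝ) * (R1 + R2)))) (P.Wn n) C1 C2) (P.qZn n) >
        Real.exp (-(β / 2 * (n : ℝ))) then 1 else 0)) ≤ _
  set a1 := Real.exp (n * R1) with ha1
  set a2 := Real.exp (n * R2) with ha2
  have ha1p : 1 ≤ a1 := Real.one_le_exp (mul_nonneg hn (by linarith))
  have ha2p : 1 ≤ a2 := Real.one_le_exp (mul_nonneg hn (by linarith))
  obtain ⟨l1, g1⟩ := numCw_bounds n (show 0 < R1 by linarith)
  obtain ⟨l2, g2⟩ := numCw_bounds n (show 0 < R2 by linarith)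
  rw [← ha1] at l1 g1
  rw [← ha2] at l2 g2
  set M1 := numCw n R1
  set M2 := numCw n R2
  set L := Real.exp (-((n : ℝ) * (R1 + R2))) with hL
  have hL0 : 0 ≤ L := (Real.exp_pos _).le
  have g1' : (M1 : ℝ) ≤ 2 * a1 := by linarith
  have g2' : (M2 : ℝ) ≤ 2 * a2 := by linarith
  set h := Real.exp (n * (ρ / 2)) with hh
  have hh0 : 0 < h := Real.exp_pos _
  have hh1 : 1 ≤ h := Real.one_le_exp (mul_nonneg hn (by linarith))
  have hi1 : L * a2 = a1⁻¹ := by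
    rw [hL, ha2, ha1, ← Real.exp_add, ← Real.exp_neg]; congr 1; ring
  have hi2 : L * a1 = a2⁻¹ := by
    rw [hL, ha2, ha1, ← Real.exp_add, ← Real.exp_neg]; congr 1; ring
  have hha : h ^ 2 = Real.exp (n * ρ) := by
    rw [hh, ← Real.exp_nat_mul]; congr 1; push_cast; ring
  have hha1 : h ^ 2 ≤ a1 := by
    rw [hha]; exact Real.exp_le_exp.2 (mul_le_mul_of_nonneg_left hρ1 hn)
  have hha2 : h ^ 2 ≤ a2 := by
    rw [hha]; exact Real.exp_le_exp.2 (mul_le_mul_of_nonneg_left hρ2 hn)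
  have sc : ∀ a M M' : ℝ, h ^ 2 ≤ a → 0 ≤ M → 0 ≤ M' → M ≤ 2 * a → L * M' ≤ 2 * a⁻¹ →
      (h / 2) * (L * M') ≤ 1 ∧ M * ((h / 2) * (L * M')) ^ 2 ≤ 2 := by
    intro a M M' hha hM hM' hMa hLM
    have ha : 0 < a := lt_of_lt_of_le (by positivity) hha
    have e1 : (h / 2) * (L * M') ≤ h * a⁻¹ := by
      calc (h / 2) * (L * M') ≤ (h / 2) * (2 * a⁻¹) := by gcongr
        _ = _ := by ring
    have e0 : 0 ≤ (h / 2) * (L * M') := by positivity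
    constructor
    · refine e1.trans ?_
      rw [← div_eq_mul_inv, div_le_one ha]
      nlinarith
    · calc M * ((h / 2) * (L * M')) ^ 2 ≤ (2 * a) * (h * a⁻¹) ^ 2 := by gcongr
        _ = 2 * (h ^ 2 / a) := by field_simp
        _ ≤ 2 * 1 := by gcongr; rwa [div_le_one ha]
        _ = 2 := by ring
  obtain ⟨sc1, sq1⟩ := sc a1 M1 M2 hha1 (Nat.cast_nonneg _) (Nat.cast_nonneg _) g1' (by
    calc L * M2 ≤ L * (2 * a2) := by gcongr
      _ = 2 * (L * a2) := by ring
      _ = _ := by rw [hi1])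
  obtain ⟨sc2, sq2⟩ := sc a2 M2 M1 hha2 (Nat.cast_nonneg _) (Nat.cast_nonneg _) g2' (by
    calc L * M1 ≤ L * (2 * a1) := by gcongr
      _ = 2 * (L * a1) := by ring
      _ = _ := by rw [hi2])
  refine (conc (pw_isP (qX_isP P) n) (pw_isP (qY_isP P) n)
    (fun C1 C2 => tvDist (outp L (P.Wn n) C1 C2) (P.qZn n)) (by positivity : 0 ≤ h / 2) sc1 sc2
    (fun C1 C2 m a => outp_diff1 hL0 (Wn_nonneg P n) (Wn_sum P n) _ C1 C2 m a)
    (fun C1 C2 m b => outp_diff2 hL0 (Wn_nonneg P n) (Wn_sum P n) _ C1 C2 m b)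
    (Real.exp (-(β / 2 * (n : ℝ))))).trans ?_
  apply Real.exp_le_exp.2
  set m := av (pw (pw P.qX n) M1) (fun C1 => av (pw (pw P.qY n) M2) (fun C2 =>
      tvDist (outp L (P.Wn n) C1 C2) (P.qZn n))) with hm
  set e := Real.exp (-(β / 2 * (n : ℝ))) with he
  have he0 : 0 < e := Real.exp_pos _
  have hee : Real.exp (-(n * β)) = e * e := by
    rw [he, ← Real.exp_add]; congr 1; ring
  have hesmall : 32 * e ≤ 1 := by
    have : 32 ≤ Real.exp (β / 2 * n) := by
      have := Real.add_one_le_exp (β / 2 * n)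
      linarith
    rw [he, Real.exp_neg, ← div_eq_mul_inv, div_le_one (Real.exp_pos _)]
    exact this
  have hm16 : m ≤ 16 * (e * e) := by
    have k1 : Real.exp (-(n * (δ / 2))) ≤ e * e := by
      rw [← hee]; exact Real.exp_le_exp.2 (neg_le_neg (mul_le_mul_of_nonneg_left hβ1 hn))
    have k2 : Real.exp (-(n * r)) ≤ e * e := by
      rw [← hee]; exact Real.exp_le_exp.2 (neg_le_neg (mul_le_mul_of_nonneg_left hβ2 hn))
    have k3 : Real.exp (-(n * ρ)) ≤ e * e := by
      rw [← hee]; exact Real.exp_le_exp.2 (neg_le_neg (mul_le_mul_of_nonneg_left (by linarith : β ≤ ρ) hn))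
    linarith
  have hm2 : m - e ≤ -(e / 2) := by
    have := mul_le_mul_of_nonneg_right hesmall he0.le
    linarith
  set y := Real.exp (ρ / 8 * n) with hy
  have hy8 : 8 ≤ y := by
    have := Real.add_one_le_exp (ρ / 8 * n)
    have : n * β ≤ n * (ρ / 2) := mul_le_mul_of_nonneg_left hβ3 hn
    linarith
  have hye : y ^ 2 ≤ h * e := by
    rw [hy, hh, he, ← Real.exp_add, ← Real.exp_nat_mul]
    apply Real.exp_le_exp.2
    have : n * β ≤ n * (ρ / 2) := mul_le_mul_of_nonneg_left hβ3 hn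
    push_cast
    linarith
  have h5 : h / 2 * (m - e) ≤ h / 2 * (-(e / 2)) := mul_le_mul_of_nonneg_left hm2 (by positivity)
  change h / 2 * (m - e) + M1 * (h / 2 * (L * M2)) ^ 2 + M2 * (h / 2 * (L * M1)) ^ 2 ≤ -y
  have h6 : 8 * y ≤ y ^ 2 := by
    rw [sq]; exact mul_le_mul_of_nonneg_right hy8 (by linarith)
  have h7 : h / 2 * (-(e / 2)) = -(h * e) / 4 := by ring
  linarith

end MACResolvability
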